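/- Let K = B₂ⁿ / vol_n(B₂ⁿ)^{1/n}, L = (1/2) B_∞ⁿ, a = 1, b = 1/(e−1), and M_n = co[(K, −a), (L, b)] ⊆ ℝ^{n+1}. Then lim_{n→∞} g(M_n) = 0, i.e. the centroid of M_n converges to the origin of ℝ^{n+1}. -/

import Mathlib

open MeasureTheory Filter
open scoped Pointwise

/-- The centroid (center of gravity) of a set `K`: `(1/vol K) ∫_K x dx`. -/
noncomputable def centroid {E : Type*} [NormedAddCommGroup E] [NormedSpace ℝ E]
    [MeasureSpace E] (K : Set E) : E :=
  ((volume K).toReal)⁻¹ • ∫ x in K, x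

/-- `K = B₂ⁿ / vol_n(B₂ⁿ)^{1/n}`, the Euclidean ball normalized to volume `1`. -/
noncomputable def normBall (n : ℕ) : Set (EuclideanSpace ℝ (Fin n)) :=
  ((volume (Metric.closedBall (0 : EuclideanSpace ℝ (Fin n)) 1)).toReal ^ (1 / (n : ℝ)))⁻¹ •
    Metric.closedBall (0 : EuclideanSpace ℝ (Fin n)) 1

/-- `L = (1/2) B_∞ⁿ`, the cube of volume `1`. -/
noncomputable def normCube (n : ℕ) : Set (EuclideanSpace ℝ (Fin n)) :=
  (1 / 2 : ℝ) • {x : EuclideanSpace ℝ (Fin n) | ∀ i, |x i| ≤ 1}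

/-- `M_n = co[(K, -a), (L, b)] ⊆ ℝ^{n+1}`. -/
noncomputable def Mbody (a b : ℝ) (n : ℕ) : Set (EuclideanSpace ℝ (Fin n) × ℝ) :=
  convexHull ℝ ((normBall n ×ˢ ({-a} : Set ℝ)) ∪ (normCube n ×ˢ ({b} : Set ℝ)))


/-- The weights `c^k / Γ(k/2+1)`. -/
noncomputable def wt (c : ℝ) (k : ℕ) : ℝ := c ^ k / Real.Gamma (k/2+1)

lemma wt_pos {c : ℝ} (hc : 0 < c) (k : ℕ) : 0 < wt c k := 
  div_pos (pow_pos hc k) (Real.Gamma_pos_of_pos (by positivity))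

lemma wt_step {c : ℝ} (k : ℕ) : ((k:ℝ)+2) * wt c (k+2) = 2 * c^2 * wt c k := by
  unfold wt
  have h : Real.Gamma (((k+2 : ℕ):ℝ)/2+1) = ((k:ℝ)/2+1) * Real.Gamma (k/2+1) := by
    rw [← Real.Gamma_add_one (by positivity)]; congr 1; push_cast; ring
  have := Real.Gamma_pos_of_pos (show (0:ℝ) < k/2+1 by positivity)
  rw [h]; field_simp; ring

lemma sum_k_wt (c : ℝ) (m : ℕ) : ∑ k ∈ Finset.range (m+2), (k:ℝ) * wt c k = 
    wt c 1 + 2*c^2 * (∑ k ∈ Finset.range (m+2), wt c k - (wt c m + wt c (m+1))) := by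
  rw [Finset.sum_range_succ', Finset.sum_range_succ', Finset.sum_range_succ _ (m+1),
    Finset.sum_range_succ _ m]
  have : ∀ k ∈ Finset.range m, (((k+1+1:ℕ)):ℝ) * wt c (k+1+1) = 2*c^2 * wt c k := by
    intro k _; rw [← wt_step]; push_cast; ring
  rw [Finset.sum_congr rfl this, ← Finset.mul_sum]
  push_cast; ring

lemma tail_bound {c : ℝ} (hc : 0 < c) (m : ℕ) (h : 2*c^2 ≤ ((m+1:ℕ):ℝ)/2) :
    (((m+1:ℕ):ℝ)/2 - 1) * (wt c m + wt c (m+1)) ≤ 2 * ∑ k ∈ Finset.range (m+2), wt c k := by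
  have step : ∀ k : ℕ, 2*c^2 ≤ (k:ℝ)+2 → wt c (k+1) + wt c (k+2) ≤ wt c k + wt c (k+1) := by
    intro k hk
    have h1 := wt_step (c := c) k
    have h2 := wt_pos hc k
    have : wt c (k+2) ≤ wt c k := by
      have h3 : ((k:ℝ)+2) * wt c (k+2) ≤ ((k:ℝ)+2) * wt c k := by
        rw [h1]; exact mul_le_mul_of_nonneg_right hk h2.le
      exact le_of_mul_le_mul_left h3 (by positivity)
    linarith
  have anti : ∀ j : ℕ, j ≤ m → ((m+1:ℕ):ℝ)/2 ≤ ((m-j:ℕ):ℝ) + 2 → 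
      wt c m + wt c (m+1) ≤ wt c (m-j) + wt c (m-j+1) := by
    intro j
    induction j with
    | zero => simp
    | succ j ih =>
      intro hj hh
      have e : m - j = m-(j+1)+1 := by omega
      have h1 := ih (by omega) (by rw [e]; push_cast at hh ⊢; linarith)
      refine h1.trans ?_
      rw [e]
      exact step _ (by linarith)
  have sum1 : ∑ j ∈ Finset.range (m+1), (wt c j + wt c (j+1)) ≤ 2 * ∑ k ∈ Finset.range (m+2), wt c k := by
    rw [Finset.sum_add_distrib, two_mul]
    have a1 := Finset.sum_range_succ (wt c) (m+1)
    have a2 := Finset.sum_range_succ' (wt c) (m+1)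
    have := wt_pos hc (m+1)
    have := wt_pos hc 0
    linarith
  refine le_trans ?_ sum1
  rw [← Finset.sum_range_reflect]
  have sub : Finset.range ((m+1)/2) ⊆ Finset.range (m+1) := Finset.range_subset_range.2 (by omega)
  refine le_trans ?_ (Finset.sum_le_sum_of_subset_of_nonneg sub 
    (fun i _ _ => (add_pos (wt_pos hc _) (wt_pos hc _)).le))
  have : ((m+1:ℕ):ℝ)/2 - 1 ≤ (((m+1)/2 : ℕ):ℝ) := by
    have : m+1 ≤ 2*((m+1)/2) + 2 := by omega
    have : ((m+1:ℕ):ℝ) ≤ 2*(((m+1)/2 : ℕ):ℝ) + 2 := by exact_mod_cast this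
    linarith
  refine (mul_le_mul_of_nonneg_right this (add_pos (wt_pos hc _) (wt_pos hc _)).le).trans ?_
  rw [← nsmul_eq_mul]
  have := Finset.card_nsmul_le_sum (Finset.range ((m+1)/2)) 
    (fun j => wt c (m+1-1-j) + wt c (m+1-1-j+1)) (wt c m + wt c (m+1)) ?_
  · simpa using this
  · intro j hj
    rw [Finset.mem_range] at hj
    have := anti j (by omega) ?_
    · simpa using this
    · have : m+1 ≤ 2*(m-j) + 4 := by omega
      have : ((m+1:ℕ):ℝ) ≤ 2*((m-j : ℕ):ℝ) + 4 := by exact_mod_cast this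
      linarith

lemma log_gamma_bound : ∃ C : ℝ, ∀ n : ℕ, 2 ≤ n → 
    |Real.log (Real.Gamma ((n:ℝ)/2+1)) - ((n:ℝ)/2 * Real.log ((n:ℝ)/2) - (n:ℝ)/2)| ≤ 
      C + 2 * Real.log (n+1) := by
  have hlim : Tendsto (fun m => Real.log (Stirling.stirlingSeq m)) atTop (nhds (Real.log (√Real.pi))) :=
    Stirling.tendsto_stirlingSeq_sqrt_pi.log (by positivity)
  obtain ⟨C, hC⟩ := hlim.abs.bddAbove_range
  refine ⟨C, fun n hn => ?_⟩
  set m := n/2 with hm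
  have hm1 : 1 ≤ m := by omega
  have hm1' : (1:ℝ) ≤ m := by exact_mod_cast hm1
  set y : ℝ := (n:ℝ)/2 with hy
  have hmy : (m:ℝ) ≤ y := by
    have : 2*m ≤ n := by omega
    have : (2*m:ℝ) ≤ n := by exact_mod_cast this
    rw [hy]; linarith
  have hym : y ≤ m + 1/2 := by
    have : n ≤ 2*m+1 := by omega
    have : (n:ℝ) ≤ 2*m+1 := by exact_mod_cast this
    rw [hy]; linarith
  have hCm : |Real.log (Stirling.stirlingSeq m)| ≤ C := hC ⟨m, rfl⟩
  have hf := Stirling.log_stirlingSeq_formula m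
  have g1 : Real.Gamma (m+1) ≤ Real.Gamma (y+1) := 
    Real.Gamma_strictMonoOn_Ici.monotoneOn (by simp; linarith) (by simp; linarith) (by linarith)
  have g2 : Real.Gamma (y+1) ≤ (m+1) * Real.Gamma (m+1) := by
    rw [← Real.Gamma_add_one (by positivity)]
    exact Real.Gamma_strictMonoOn_Ici.monotoneOn (by simp; linarith) (by simp; linarith) (by linarith)
  have gp := Real.Gamma_pos_of_pos (show (0:ℝ) < m+1 by positivity)
  have l1 := Real.log_le_log gp g1
  have l2 := Real.log_le_log (lt_of_lt_of_le gp g1) g2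
  rw [Real.log_mul (by positivity) gp.ne'] at l2
  rw [Real.Gamma_nat_eq_factorial] at l1 l2
  have m0 : (0:ℝ) < m := by linarith
  have y0 : (0:ℝ) < y := by linarith
  have p1 : Real.log y - Real.log m ≤ y/m - 1 := by
    rw [← Real.log_div y0.ne' m0.ne']; exact Real.log_le_sub_one_of_pos (by positivity)
  have p2 : Real.log m - Real.log y ≤ m/y - 1 := by
    rw [← Real.log_div m0.ne' y0.ne']; exact Real.log_le_sub_one_of_pos (by positivity)
  have p1' : m * (Real.log y - Real.log m) ≤ y - m := by
    have := mul_le_mul_of_nonneg_left p1 m0.le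
    have e : m * (y/m - 1) = y - m := by field_simp
    linarith
  have p2' : y * (Real.log m - Real.log y) ≤ m - y := by
    have := mul_le_mul_of_nonneg_left p2 y0.le
    have e : y * (m/y - 1) = m - y := by field_simp
    linarith
  have q0 : 0 ≤ Real.log m := Real.log_nonneg hm1'
  have q1 : Real.log y ≤ Real.log (m+1) := Real.log_le_log y0 (by linarith)
  have q2 : Real.log (m+1) ≤ Real.log (n+1) := Real.log_le_log (by linarith) (by
    have : (n:ℝ) = 2*y := by rw [hy]; ring
    linarith)
  have q3 : Real.log (2*m) ≤ Real.log (n+1) := Real.log_le_log (by linarith) (by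
    have : (n:ℝ) = 2*y := by rw [hy]; ring
    linarith)
  have q4 : 0 ≤ Real.log (2*m) := Real.log_nonneg (by linarith)
  have q5 : 0 ≤ (y-m) * Real.log m := mul_nonneg (by linarith) q0
  have q7 : 0 ≤ Real.log y := Real.log_nonneg (by linarith)
  have q6 : (y-m) * Real.log y ≤ Real.log (m+1) := by nlinarith
  rw [Real.log_div m0.ne' (Real.exp_pos 1).ne', Real.log_exp] at hf
  rw [abs_le] at hCm ⊢
  constructor <;> nlinarith

lemma ratio_lim (c : ℕ → ℝ) (hc : ∀ n, 1 ≤ n → 0 < c n) 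
    (hcn : ∀ n, 1 ≤ n → c n ^ n = Real.Gamma ((n:ℝ)/2+1)) :
    Tendsto (fun n : ℕ => 2 * c n ^ 2 / n) atTop (nhds (Real.exp (-1))) := by
  obtain ⟨C, hC⟩ := log_gamma_bound
  have hlog : Tendsto (fun n : ℕ => Real.log ((n:ℝ)+1) / n) atTop (nhds 0) := by
    have h1 := (Real.isLittleO_log_id_atTop.tendsto_div_nhds_zero).comp 
      (tendsto_atTop_add_const_right atTop (1:ℝ) tendsto_natCast_atTop_atTop)
    have h2 : Tendsto (fun n : ℕ => 1 + 1/(n:ℝ)) atTop (nhds (1+0)) := 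
      tendsto_const_nhds.add tendsto_one_div_atTop_nhds_zero_nat
    have h3 := h1.mul h2
    rw [zero_mul] at h3
    refine h3.congr' ?_
    filter_upwards [eventually_ge_atTop 1] with n hn
    have : (0:ℝ) < n := by exact_mod_cast hn
    simp only [Function.comp, id]
    field_simp
  have hE : Tendsto (fun n : ℕ => (Real.log (Real.Gamma ((n:ℝ)/2+1)) - ((n:ℝ)/2 * Real.log ((n:ℝ)/2) - (n:ℝ)/2)) / ((n:ℝ)/2)) atTop (nhds 0) := by
    have hb : Tendsto (fun n : ℕ => 2*C*(1/(n:ℝ)) + 4 * (Real.log ((n:ℝ)+1) / n)) atTop (nhds (2*C*0+4*0)) :=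
      (tendsto_one_div_atTop_nhds_zero_nat.const_mul _).add (hlog.const_mul _)
    rw [mul_zero, mul_zero, add_zero] at hb
    refine squeeze_zero_norm' ?_ hb
    filter_upwards [eventually_ge_atTop 2] with n hn
    have n0 : (0:ℝ) < n := by exact_mod_cast (by omega : 0 < n)
    rw [Real.norm_eq_abs, abs_div, abs_of_pos (show (0:ℝ) < n/2 by positivity), div_le_iff₀ (by positivity)]
    refine (hC n hn).trans (le_of_eq ?_)
    field_simp; ring
  have := ((hE.const_add (-1)).rexp)
  rw [add_zero] at this
  refine this.congr' ?_
  filter_upwards [eventually_ge_atTop 1] with n hn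
  have n0 : (0:ℝ) < n := by exact_mod_cast hn
  have hcp := hc n hn
  rw [← hcn n hn, Real.log_pow]
  have e : -1 + (n * Real.log (c n) - ((n:ℝ)/2 * Real.log ((n:ℝ)/2) - (n:ℝ)/2)) / ((n:ℝ)/2) = 
     Real.log (2 * c n ^ 2 / n) := by
    have : 2 * c n ^ 2 / n = c n ^ 2 / (n/2) := by field_simp
    rw [this, Real.log_div (x := c n ^ 2) (y := (n:ℝ)/2) (by positivity) (by positivity), Real.log_pow]
    field_simp; push_cast; ring
  rw [e, Real.exp_log (by positivity)]

lemma mean_lim (c : ℕ → ℝ) (hc : ∀ n, 1 ≤ n → 0 < c n) 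
    (hcn : ∀ n, 1 ≤ n → c n ^ n = Real.Gamma ((n:ℝ)/2+1)) :
    Tendsto (fun n : ℕ => (∑ k ∈ Finset.range (n+1), (k:ℝ) * wt (c n) k) / 
      (n * ∑ k ∈ Finset.range (n+1), wt (c n) k)) atTop (nhds (Real.exp (-1))) := by
  have hr := ratio_lim c hc hcn
  have hev : ∀ᶠ n : ℕ in atTop, 2 * c n ^ 2 / n ≤ 1/2 := by
    refine (hr.eventually_lt_const (?_ : Real.exp (-1) < 1/2)).mono fun n h => h.le
    rw [Real.exp_neg, inv_lt_comm₀ (Real.exp_pos _) (by norm_num)]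
    have := Real.exp_one_gt_d9
    norm_num; linarith
  have hS : ∀ n, 1 ≤ n → 0 < ∑ k ∈ Finset.range (n+1), wt (c n) k := fun n hn =>
    Finset.sum_pos (fun k _ => wt_pos (hc n hn) k) ⟨0, by simp⟩
  have h1 : Tendsto (fun n : ℕ => wt (c n) 1 / (n * ∑ k ∈ Finset.range (n+1), wt (c n) k)) atTop (nhds 0) := by
    refine squeeze_zero' ?_ ?_ tendsto_one_div_atTop_nhds_zero_nat
    · filter_upwards [eventually_ge_atTop 1] with n hn
      exact div_nonneg (wt_pos (hc n hn) _).le (mul_nonneg (by positivity) (hS n hn).le)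
    · filter_upwards [eventually_ge_atTop 1] with n hn
      have n0 : (0:ℝ) < n := by exact_mod_cast hn
      have : wt (c n) 1 ≤ ∑ k ∈ Finset.range (n+1), wt (c n) k := 
        Finset.single_le_sum (f := wt (c n)) (fun k _ => (wt_pos (hc n hn) k).le) (by simp; omega)
      have := hS n hn
      rw [div_le_div_iff₀ (by positivity) n0]
      nlinarith
  have h2 : Tendsto (fun n : ℕ => (wt (c n) (n-1) + wt (c n) n) / (∑ k ∈ Finset.range (n+1), wt (c n) k)) atTop (nhds 0) := by
    have hb : Tendsto (fun n : ℕ => 2 / ((n:ℝ)/2 - 1)) atTop (nhds 0) := by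
      refine Tendsto.const_div_atTop ?_ _
      refine tendsto_atTop_add_const_right _ (-1) ?_
      exact tendsto_natCast_atTop_atTop.atTop_div_const (by norm_num)
    refine squeeze_zero' ?_ ?_ hb
    · filter_upwards [eventually_ge_atTop 1] with n hn
      exact div_nonneg (add_pos (wt_pos (hc n hn) _) (wt_pos (hc n hn) _)).le (hS n hn).le
    · filter_upwards [eventually_ge_atTop 3, hev] with n hn he
      have n0 : (3:ℝ) ≤ n := by exact_mod_cast hn
      obtain ⟨m, rfl⟩ : ∃ m, n = m+1 := ⟨n-1, by omega⟩
      rw [div_le_iff₀ (by linarith)] at he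
      have := tail_bound (hc (m+1) (by omega)) m (by linarith)
      have hs := hS (m+1) (by omega)
      rw [div_le_div_iff₀ hs (by linarith)]
      simp only [Nat.add_sub_cancel]
      linarith
  have h3 := h1.add (hr.mul (h2.const_sub 1))
  rw [sub_zero, mul_one, zero_add] at h3
  refine h3.congr' ?_
  filter_upwards [eventually_ge_atTop 1] with n hn
  obtain ⟨m, rfl⟩ : ∃ m, n = m+1 := ⟨n-1, by omega⟩
  have hs := hS (m+1) (by omega)
  rw [sum_k_wt]
  simp only [Nat.add_sub_cancel]
  have n0 : (0:ℝ) < ((m+1:ℕ):ℝ) := by positivity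
  field_simp


/-- Volume of `{x ∈ ℝⁿ : ∑ g (x i) ≤ u}`. -/
noncomputable def sumVol (g : ℝ → ℝ) (n : ℕ) (u : ℝ) : ENNReal :=
  volume {x : Fin n → ℝ | ∑ i, g (x i) ≤ u}

lemma sumVol_mono (g : ℝ → ℝ) (n : ℕ) : Monotone (sumVol g n) := by
  intro u v h
  exact measure_mono fun x hx => le_trans hx h

lemma sumVol_succ (g : ℝ → ℝ) (hg : Measurable g) (n : ℕ) (u : ℝ) :
    sumVol g (n+1) u = ∫⁻ y, sumVol g n (u - g y) := by
  have hm : ∀ n : ℕ, MeasurableSet {x : Fin n → ℝ | ∑ i, g (x i) ≤ u} := fun n =>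
    measurableSet_le (by fun_prop) measurable_const
  have hp := (volume_preserving_piFinSuccAbove (fun _ : Fin (n+1) => ℝ) 0).symm
  unfold sumVol
  rw [← hp.measure_preimage_equiv]
  rw [Measure.volume_eq_prod, Measure.prod_apply]
  · congr 1
    ext y
    congr 1
    ext x
    simp [Fin.sum_univ_succ, MeasurableEquiv.piFinSuccAbove, Fin.insertNthEquiv]
    constructor <;> intro h <;> linarith
  · exact (MeasurableEquiv.measurable _) (hm (n+1))

/-- The squared distance to `[-s/2, s/2]`. -/
noncomputable def clipSq (s y : ℝ) : ℝ := (max (|y| - s/2) 0)^2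

lemma clipSq_cont (s : ℝ) : Continuous (clipSq s) := by unfold clipSq; fun_prop

lemma lintegral_clipSq (s : ℝ) (hs : 0 ≤ s) (h : ℝ → ENNReal) (hh : Measurable h) :
    ∫⁻ y, h (clipSq s y) = ENNReal.ofReal s * h 0 + ∫⁻ y, h (y^2) := by
  have hc := (clipSq_cont s).measurable
  have h1 : ∫⁻ y in Set.Iio (-(s/2)), h (clipSq s y) = ∫⁻ y in Set.Iio (0:ℝ), h (y^2) := by
    have := (measurePreserving_add_right (volume : Measure ℝ) (s/2)).setLIntegral_comp_preimage
      (s := Set.Iio (0:ℝ)) measurableSet_Iio (f := fun y => h (y^2)) (by fun_prop)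
    rw [← this]
    have e : (fun x => x + s/2) ⁻¹' Set.Iio (0:ℝ) = Set.Iio (-(s/2)) := by
      ext x; simp [lt_neg_iff_add_neg]
    rw [e]
    refine setLIntegral_congr_fun measurableSet_Iio fun y hy => ?_
    simp only [Set.mem_Iio] at hy
    simp only [clipSq]
    rw [abs_of_neg (by linarith), max_eq_left (by linarith)]
    congr 1; ring
  have h2 : ∫⁻ y in Set.Ioi ((s/2)), h (clipSq s y) = ∫⁻ y in Set.Ioi (0:ℝ), h (y^2) := by
    have := (measurePreserving_add_right (volume : Measure ℝ) (-(s/2))).setLIntegral_comp_preimage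
      (s := Set.Ioi (0:ℝ)) measurableSet_Ioi (f := fun y => h (y^2)) (by fun_prop)
    rw [← this]
    have e : (fun x => x + -(s/2)) ⁻¹' Set.Ioi (0:ℝ) = Set.Ioi ((s/2)) := by
      ext x; simp
    rw [e]
    refine setLIntegral_congr_fun measurableSet_Ioi fun y hy => ?_
    simp only [Set.mem_Ioi] at hy
    simp only [clipSq]
    rw [abs_of_pos (by linarith), max_eq_left (by linarith)]
    congr 1
  have h3 : ∫⁻ y in Set.Icc (-(s/2)) (s/2), h (clipSq s y) = ENNReal.ofReal s * h 0 := by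
    rw [setLIntegral_congr_fun (g := fun _ => h 0) measurableSet_Icc]
    · rw [setLIntegral_const, Real.volume_Icc, mul_comm]; congr 2; ring
    · intro y hy
      have : |y| ≤ s/2 := abs_le.2 hy
      simp only [clipSq]
      rw [max_eq_right (by linarith)]; simp
  have h4 : ∫⁻ y, h (y^2) = (∫⁻ y in Set.Iio (0:ℝ), h (y^2)) + ∫⁻ y in Set.Ioi (0:ℝ), h (y^2) := by
    rw [← lintegral_add_compl (fun y => h (y^2)) (measurableSet_Iio (a := (0:ℝ))), Set.compl_Iio,
      setLIntegral_congr Ioi_ae_eq_Ici]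
  have h5 : (Set.Iio (-(s/2)))ᶜ = Set.Icc (-(s/2)) (s/2) ∪ Set.Ioi (s/2) := by
    rw [Set.compl_Iio, Set.Icc_union_Ioi_eq_Ici (by linarith)]
  rw [← lintegral_add_compl _ (measurableSet_Iio (a := -(s/2))), h5,
    lintegral_union measurableSet_Ioi, h1, h2, h3, h4]
  · ring
  · rw [Set.disjoint_left]; intro x hx hy; exact absurd hx.2 (not_le.2 hy)

/-- Steiner formula for the cube. -/
lemma steiner (s : ℝ) (hs : 0 ≤ s) (n : ℕ) (u : ℝ) :
    sumVol (clipSq s) n u = ∑ k ∈ Finset.range (n+1), 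
      (n.choose k : ENNReal) * ENNReal.ofReal s ^ (n-k) * sumVol (fun y => y^2) k u := by
  induction n generalizing u with
  | zero => simp [sumVol]
  | succ n ih =>
    have hmeas : ∀ k, Measurable fun y : ℝ => sumVol (fun y => y^2) k (u - y^2) := fun k =>
      (sumVol_mono _ k).measurable.comp (by fun_prop)
    rw [sumVol_succ _ (clipSq_cont s).measurable,
      lintegral_clipSq s hs (fun w => sumVol (clipSq s) n (u - w)) 
      ((sumVol_mono _ n).measurable.comp (by fun_prop))]
    simp only [ih, sub_zero]
    rw [lintegral_finsetSum _ (fun k _ => (hmeas k).const_mul _)]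
    simp_rw [lintegral_const_mul _ (hmeas _), ← sumVol_succ (fun y => y^2) (by fun_prop)]
    rw [Finset.sum_range_succ' _ (n+1)]
    have e : ∀ k ∈ Finset.range (n+1), ((n+1).choose (k+1) : ENNReal) * ENNReal.ofReal s ^ (n+1-(k+1)) * sumVol (fun y => y^2) (k+1) u
      = (n.choose k : ENNReal) * ENNReal.ofReal s ^ (n-k) * sumVol (fun y => y^2) (k+1) u + 
       (n.choose (k+1) : ENNReal) * ENNReal.ofReal s ^ (n-k) * sumVol (fun y => y^2) (k+1) u := by
      intro k _
      rw [Nat.choose_succ_succ]; push_cast; rw [Nat.succ_eq_add_one]; ring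
    rw [Finset.sum_congr rfl e, Finset.sum_add_distrib, add_comm, add_assoc]
    congr 1
    rw [Finset.sum_range_succ' _ n, Finset.sum_range_succ _ n, mul_add, Finset.mul_sum]
    congr 1
    · simp only [Nat.choose_succ_self]
      simp only [Nat.cast_zero, zero_mul, add_zero]
      refine Finset.sum_congr rfl fun k hk => ?_
      have : n - k = (n - (k+1)) + 1 := by have := Finset.mem_range.1 hk; omega
      rw [this, pow_succ]; ring
    · simp [pow_succ]; ring

lemma sumVol_sq (k : ℕ) (ρ : ℝ) (hρ : 0 ≤ ρ) : 
    sumVol (fun y => y^2) k (ρ^2) = ENNReal.ofReal (ρ^k * (√Real.pi ^ k / Real.Gamma (k/2+1))) := by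
  rcases Nat.eq_zero_or_pos k with rfl | hk
  · simp [sumVol, sq_nonneg, volume_pi]
  · have : Nonempty (Fin k) := ⟨⟨0, hk⟩⟩
    have := EuclideanSpace.volume_closedBall (Fin k) 0 ρ
    rw [Fintype.card_fin, ← ENNReal.ofReal_pow hρ, ← ENNReal.ofReal_mul (by positivity)] at this
    rw [← this, ← (PiLp.volume_preserving_toLp (Fin k)).measure_preimage 
      Metric.isClosed_closedBall.measurableSet.nullMeasurableSet]
    unfold sumVol
    congr 1
    ext x
    simp only [Set.mem_ofPred_eq, Set.mem_preimage, mem_closedBall_zero_iff, EuclideanSpace.norm_eq]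
    rw [Real.sqrt_le_left hρ]
    simp

/-- Radius of the normalized ball. -/
noncomputable def nrad (n : ℕ) : ℝ :=
  ((volume (Metric.closedBall (0 : EuclideanSpace ℝ (Fin n)) 1)).toReal ^ (1 / (n : ℝ)))⁻¹

lemma nrad_nonneg (n : ℕ) : 0 ≤ nrad n := by unfold nrad; positivity

lemma normBall_eq (n : ℕ) : normBall n = Metric.closedBall 0 (nrad n) := by
  unfold normBall
  change nrad n • _ = _
  rw [smul_unitClosedBall, Real.norm_of_nonneg (nrad_nonneg n)]

lemma nrad_spec (n : ℕ) (hn : 1 ≤ n) : 0 < nrad n * √Real.pi ∧ 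
    (nrad n * √Real.pi)^n = Real.Gamma ((n:ℝ)/2+1) := by
  have : Nonempty (Fin n) := ⟨⟨0, hn⟩⟩
  have g := Real.Gamma_pos_of_pos (show (0:ℝ) < n/2+1 by positivity)
  have e : (volume (Metric.closedBall (0 : EuclideanSpace ℝ (Fin n)) 1)).toReal 
      = √Real.pi ^ n / Real.Gamma ((n:ℝ)/2+1) := by
    rw [EuclideanSpace.volume_closedBall]
    simp
    positivity
  have p : 0 < √Real.pi ^ n / Real.Gamma ((n:ℝ)/2+1) := by positivity
  have r : 0 < nrad n := by unfold nrad; rw [e]; positivity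
  refine ⟨by positivity, ?_⟩
  rw [mul_pow]
  unfold nrad
  rw [e, inv_pow, one_div, Real.rpow_inv_natCast_pow p.le (by omega)]
  field_simp

lemma mem_normCube (n : ℕ) (x : EuclideanSpace ℝ (Fin n)) : 
    x ∈ normCube n ↔ ∀ i, |x i| ≤ 1/2 := by
  unfold normCube
  rw [Set.mem_smul_set_iff_inv_smul_mem₀ (by norm_num)]
  simp only [Set.mem_ofPred_eq, PiLp.smul_apply, smul_eq_mul, abs_mul]
  refine forall_congr' fun i => ?_
  norm_num
  constructor <;> intro h <;> linarith

set_option maxHeartbeats 2000000 in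
lemma mem_Mbody (b : ℝ) (hb : -1 < b) (n : ℕ) (x : EuclideanSpace ℝ (Fin n)) (t : ℝ) :
    (x, t) ∈ Mbody 1 b n ↔ (-1 ≤ t ∧ t ≤ b) ∧ 
      ∑ i, clipSq ((t+1)/(1+b)) (x i) ≤ ((1 - (t+1)/(1+b)) * nrad n)^2 := by
  have hb' : 0 < 1 + b := by linarith
  have hr := nrad_nonneg n
  have cL : Convex ℝ (normCube n) := by
    intro x hx y hy p q hp hq hpq
    rw [mem_normCube] at *
    intro i
    simp only [PiLp.add_apply, PiLp.smul_apply, smul_eq_mul]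
    refine (abs_add_le _ _).trans ?_
    rw [abs_mul, abs_mul, abs_of_nonneg hp, abs_of_nonneg hq]
    nlinarith [hx i, hy i]
  unfold Mbody
  rw [normBall_eq, Convex.convexHull_union ((convex_closedBall _ _).prod (convex_singleton _)) 
    (cL.prod (convex_singleton _)) 
    ⟨(0, -1), by simp [hr]⟩ ⟨(0, b), by simp [mem_normCube]⟩, mem_convexJoin]
  constructor
  · rintro ⟨⟨k, t1⟩, hk, ⟨l, t2⟩, hl, p, s, hp, hs, hps, heq⟩
    simp only [Set.mem_prod, Set.mem_singleton_iff, mem_closedBall_zero_iff, mem_normCube] at hk hl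
    obtain ⟨hk, rfl⟩ := hk
    obtain ⟨hl, rfl⟩ := hl
    simp only [Prod.smul_mk, Prod.mk_add_mk, Prod.mk.injEq, smul_eq_mul] at heq
    obtain ⟨rfl, rfl⟩ := heq
    have hs' : (p * -1 + s * t2 + 1)/(1+t2) = s := by
      rw [div_eq_iff hb'.ne', ← hps]; nlinarith
    have hp' : 1 - s = p := by linarith
    rw [hs', hp']
    refine ⟨⟨by nlinarith, by nlinarith⟩, ?_⟩
    have hk2 : ∑ i, (k i)^2 ≤ nrad n ^ 2 := by
      have := EuclideanSpace.norm_sq_eq k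
      simp only [Real.norm_eq_abs, sq_abs] at this
      rw [← this]
      exact pow_le_pow_left₀ (norm_nonneg _) hk 2
    calc _ ≤ ∑ i, p^2 * (k i)^2 := by
          refine Finset.sum_le_sum fun i _ => ?_
          unfold clipSq
          have h1 : max (|(p • k + s • l) i| - s/2) 0 ≤ p * |k i| := by
            refine max_le ?_ (by positivity)
            simp only [PiLp.add_apply, PiLp.smul_apply, smul_eq_mul]
            have := abs_add_le (p * k i) (s * l i)
            rw [abs_mul, abs_mul, abs_of_nonneg hp, abs_of_nonneg hs] at this
            nlinarith [hl i]
          calc _ ≤ (p * |k i|)^2 := pow_le_pow_left₀ (le_max_right _ _) h1 2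
            _ = _ := by rw [mul_pow, sq_abs]
      _ = p^2 * ∑ i, (k i)^2 := by rw [Finset.mul_sum]
      _ ≤ p^2 * nrad n ^ 2 := by gcongr
      _ = _ := by ring
  · rintro ⟨⟨h1, h2⟩, h3⟩
    set s := (t+1)/(1+b) with hsdef
    have hs0 : 0 ≤ s := div_nonneg (by linarith) hb'.le
    have hs1 : s ≤ 1 := by rw [hsdef, div_le_one hb']; linarith
    have hst : s * (1+b) = t+1 := by rw [hsdef]; field_simp
    let cl : Fin n → ℝ := fun i => max (-(s/2)) (min (x i) (s/2))
    have hcl : ∀ i, |cl i| ≤ s/2 := fun i => abs_le.2 ⟨le_max_left _ _, max_le (by linarith) (min_le_right _ _)⟩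
    have hd : ∀ i, (x i - cl i)^2 = clipSq s (x i) := by
      intro i
      simp only [cl, clipSq]
      rcases le_total (x i) (s/2) with h | h
      · rw [min_eq_left h]
        rcases le_total (-(s/2)) (x i) with h' | h'
        · rw [max_eq_right h', max_eq_right (by have := abs_le.2 ⟨h', h⟩; linarith)]; ring
        · rw [max_eq_left h', abs_of_nonpos (by linarith), max_eq_left (by linarith)]; ring
      · rw [min_eq_right h, max_eq_right (by linarith), abs_of_nonneg (by linarith), max_eq_left (by linarith)]
    simp_rw [← hd] at h3
    have hsc : ∀ i, s * (s⁻¹ * cl i) = cl i := by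
      intro i
      rcases eq_or_ne s 0 with h | h
      · have := hcl i
        rw [h, zero_div] at this
        have := abs_nonpos_iff.1 this
        rw [this]; simp
      · field_simp
    have hsd : ∀ i, (1-s) * ((1-s)⁻¹ * (x i - cl i)) = x i - cl i := by
      intro i
      rcases eq_or_ne (1-s) 0 with h | h
      · rw [h, zero_mul] at h3
        have h4 : (x i - cl i)^2 ≤ 0 ^ 2 := (Finset.single_le_sum (f := fun i => (x i - cl i)^2) (fun j _ => sq_nonneg _) (Finset.mem_univ i)).trans h3
        have : x i - cl i = 0 := by nlinarith
        rw [this]; simp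
      · field_simp
    refine ⟨(WithLp.toLp 2 fun i => (1-s)⁻¹ * (x i - cl i), -1), ?_, 
      (WithLp.toLp 2 fun i => s⁻¹ * cl i, b), ?_, 1-s, s, by linarith, hs0, by ring, ?_⟩
    · simp only [Set.mem_prod, Set.mem_singleton_iff, mem_closedBall_zero_iff, and_true]
      rw [EuclideanSpace.norm_eq, Real.sqrt_le_left hr]
      simp only [Real.norm_eq_abs, sq_abs, mul_pow]
      rw [← Finset.mul_sum]
      rcases eq_or_ne (1-s) 0 with h | h
      · rw [h]; simp; positivity
      · rw [mul_pow] at h3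
        have : 0 < (1-s)^2 := by positivity
        calc _ ≤ (1-s)⁻¹^2 * ((1-s)^2 * nrad n ^ 2) := by gcongr
          _ = _ := by field_simp
    · simp only [Set.mem_prod, Set.mem_singleton_iff, mem_normCube, and_true]
      intro i
      rw [abs_mul, abs_inv, abs_of_nonneg hs0]
      rcases eq_or_ne s 0 with h | h
      · rw [h]; simp
      · calc _ ≤ s⁻¹ * (s/2) := by gcongr; exact hcl i
          _ = _ := by field_simp
    · ext i
      · simp [hsc, hsd]
      · simp; linarith

/-- Section volume as a function of the parameter. -/
noncomputable def secVol (n : ℕ) (s : ℝ) : ℝ :=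
  ∑ k ∈ Finset.range (n+1), (n.choose k : ℝ) * s^(n-k) * (1-s)^k * wt (nrad n * √Real.pi) k

lemma section_vol (b : ℝ) (hb : -1 < b) (n : ℕ) (t : ℝ) (ht : t ∈ Set.Icc (-1) b) :
    volume.real {x : EuclideanSpace ℝ (Fin n) | (x,t) ∈ Mbody 1 b n} = secVol n ((t+1)/(1+b)) := by
  have hb' : 0 < 1 + b := by linarith
  have hr := nrad_nonneg n
  set s := (t+1)/(1+b) with hsdef
  have hs0 : 0 ≤ s := div_nonneg (by linarith [ht.1]) hb'.le
  have hs1 : s ≤ 1 := by rw [hsdef, div_le_one hb']; linarith [ht.2]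
  have hg : ∀ k : ℕ, 0 < Real.Gamma ((k:ℝ)/2+1) := fun k => Real.Gamma_pos_of_pos (by positivity)
  have e : {x : EuclideanSpace ℝ (Fin n) | (x,t) ∈ Mbody 1 b n} = 
    {x : EuclideanSpace ℝ (Fin n) | ∑ i, clipSq s (x i) ≤ ((1 - s) * nrad n)^2} := by
    ext x
    simp only [Set.mem_ofPred_eq]
    rw [mem_Mbody b hb]
    exact and_iff_right ht
  have hm : MeasurableSet {x : EuclideanSpace ℝ (Fin n) | ∑ i, clipSq s (x i) ≤ ((1 - s) * nrad n)^2} := by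
    refine (isClosed_le ?_ continuous_const).measurableSet
    exact continuous_finsetSum _ fun i _ => (clipSq_cont s).comp (by fun_prop)
  have e2 : volume {x : EuclideanSpace ℝ (Fin n) | ∑ i, clipSq s (x i) ≤ ((1 - s) * nrad n)^2} = 
      sumVol (clipSq s) n (((1 - s) * nrad n)^2) := by
    rw [← (PiLp.volume_preserving_toLp (Fin n)).measure_preimage hm.nullMeasurableSet]
    rfl
  have h1s : 0 ≤ 1 - s := by linarith
  rw [e, Measure.real, e2, steiner s hs0, ENNReal.toReal_sum]
  · refine Finset.sum_congr rfl fun k _ => ?_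
    rw [sumVol_sq k _ (by positivity)]
    have := hg k
    rw [ENNReal.toReal_mul, ENNReal.toReal_mul, ENNReal.toReal_pow, ENNReal.toReal_ofReal hs0, 
      ENNReal.toReal_ofReal (by positivity), ENNReal.toReal_natCast]
    unfold wt
    rw [mul_pow, mul_pow]
    ring
  · intro k _
    rw [sumVol_sq k _ (by positivity)]
    finiteness

lemma Mbody_compact (b : ℝ) (hb : -1 < b) (n : ℕ) : IsCompact (Mbody 1 b n) := by
  rw [Metric.isCompact_iff_isClosed_bounded]
  constructor
  · have : Mbody 1 b n = {p | (-1 ≤ p.2 ∧ p.2 ≤ b) ∧ 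
      ∑ i, clipSq ((p.2+1)/(1+b)) (p.1 i) ≤ ((1 - (p.2+1)/(1+b)) * nrad n)^2} := by
      ext ⟨x, t⟩
      exact mem_Mbody b hb n x t
    rw [this]
    unfold clipSq
    have k1 : IsClosed {p : EuclideanSpace ℝ (Fin n) × ℝ | -1 ≤ p.2} := isClosed_le (by fun_prop) (by fun_prop)
    have k2 : IsClosed {p : EuclideanSpace ℝ (Fin n) × ℝ | p.2 ≤ b} := isClosed_le (by fun_prop) (by fun_prop)
    have k3 : IsClosed {p : EuclideanSpace ℝ (Fin n) × ℝ | ∑ i, (max (|p.1 i| - (p.2+1)/(1+b)/2) 0)^2 ≤ ((1 - (p.2+1)/(1+b)) * nrad n)^2} :=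
      isClosed_le (by fun_prop) (by fun_prop)
    exact (k1.inter k2).inter k3
  · unfold Mbody
    rw [isBounded_convexHull]
    refine Bornology.IsBounded.union (Bornology.IsBounded.prod ?_ Bornology.isBounded_singleton) 
      (Bornology.IsBounded.prod ?_ Bornology.isBounded_singleton)
    · rw [normBall_eq]; exact Metric.isBounded_closedBall
    · refine (Metric.isBounded_closedBall (x := (0:EuclideanSpace ℝ (Fin n))) (r := √ (∑ i : Fin n, 1))).subset ?_
      intro x hx
      rw [mem_normCube] at hx
      rw [mem_closedBall_zero_iff, EuclideanSpace.norm_eq]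
      refine Real.sqrt_le_sqrt (Finset.sum_le_sum fun i _ => ?_)
      rw [Real.norm_eq_abs]
      have := hx i
      have := abs_nonneg (x i)
      nlinarith

lemma integral_Mbody (b : ℝ) (hb : -1 < b) (n : ℕ) (g : ℝ → ℝ) (hg : Continuous g) :
    ∫ p in Mbody 1 b n, g p.2 = (1+b) * ∫ s in (0:ℝ)..1, g (-1 + s*(1+b)) * secVol n s := by
  have hb' : 0 < 1 + b := by linarith
  have hM := Mbody_compact b hb n
  have hMm := hM.isClosed.measurableSet
  have hint : IntegrableOn (fun p : EuclideanSpace ℝ (Fin n) × ℝ => g p.2) (Mbody 1 b n) :=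
    ContinuousOn.integrableOn_compact hM (by fun_prop)
  rw [← integral_indicator hMm, Measure.volume_eq_prod, integral_prod_symm]
  swap
  · rw [← Measure.volume_eq_prod]; exact (integrable_indicator_iff hMm).2 hint
  have hsec : ∀ t, ∫ x, (Mbody 1 b n).indicator (fun p : EuclideanSpace ℝ (Fin n) × ℝ => g p.2) (x,t) = 
      (Set.Icc (-1) b).indicator (fun t => g t * secVol n ((t+1)/(1+b))) t := by
    intro t
    have hm : MeasurableSet {x : EuclideanSpace ℝ (Fin n) | (x,t) ∈ Mbody 1 b n} := 
      hMm.preimage (by fun_prop : Measurable fun x => (x,t))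
    have : (fun x => (Mbody 1 b n).indicator (fun p : EuclideanSpace ℝ (Fin n) × ℝ => g p.2) (x,t)) = 
      {x : EuclideanSpace ℝ (Fin n) | (x,t) ∈ Mbody 1 b n}.indicator (fun _ => g t) := by
      ext x
      simp [Set.indicator]
    rw [this, integral_indicator_const _ hm]
    by_cases ht : t ∈ Set.Icc (-1) b
    · rw [Set.indicator_of_mem ht, section_vol b hb n t ht, smul_eq_mul, mul_comm]
    · rw [Set.indicator_of_notMem ht]
      have : {x : EuclideanSpace ℝ (Fin n) | (x,t) ∈ Mbody 1 b n} = ∅ := by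
        ext x
        simp only [Set.mem_ofPred_eq, Set.mem_empty_iff_false, iff_false]
        rw [mem_Mbody b hb]
        exact fun h => ht h.1
      rw [this]; simp
  simp_rw [hsec]
  rw [integral_indicator measurableSet_Icc, integral_Icc_eq_integral_Ioc, 
    ← intervalIntegral.integral_of_le hb.le]
  have := intervalIntegral.smul_integral_comp_add_mul (a := 0) (b := 1) 
    (fun t => g t * secVol n ((t+1)/(1+b))) (1+b) (-1)
  rw [show (-1:ℝ) + (1+b) * 0 = -1 by ring, show (-1:ℝ) + (1+b) * 1 = b by ring] at this
  rw [← this, smul_eq_mul]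
  congr 1
  refine intervalIntegral.integral_congr fun s _ => ?_
  rw [show (-1 + (1+b)*s + 1)/(1+b) = s by field_simp; ring, mul_comm s]

lemma beta_nat (a k : ℕ) : ∫ s in (0:ℝ)..1, s^a * (1-s)^k = (a.factorial * k.factorial : ℝ) / (a+k+1).factorial := by
  induction k generalizing a with
  | zero =>
    simp [integral_pow, Nat.factorial_succ]
    have : (a.factorial : ℝ) ≠ 0 := by positivity
    field_simp
  | succ k ih =>
    have hd : ∀ s ∈ Set.uIcc (0:ℝ) 1, HasDerivAt (fun s : ℝ => s^(a+1) * (1-s)^(k+1)) 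
      ((a+1) * (s^a * (1-s)^(k+1)) - (k+1) * (s^(a+1) * (1-s)^k)) s := by
      intro s _
      have h1 := hasDerivAt_pow (a+1) s
      have h2 := ((hasDerivAt_id s).const_sub 1).pow (k+1)
      refine (h1.mul h2).congr_deriv ?_
      simp only [Nat.add_sub_cancel, id, Pi.pow_apply]
      push_cast
      ring
    have hI := intervalIntegral.integral_eq_sub_of_hasDerivAt hd 
      (Continuous.intervalIntegrable (by fun_prop) _ _)
    rw [intervalIntegral.integral_sub (Continuous.intervalIntegrable (by fun_prop) _ _) 
      (Continuous.intervalIntegrable (by fun_prop) _ _), intervalIntegral.integral_const_mul, 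
      intervalIntegral.integral_const_mul, ih] at hI
    simp at hI
    have e : a + (k+1) + 1 = a+1+k+1 := by ring
    rw [e]
    have a0 : (a:ℝ)+1 ≠ 0 := by positivity
    have : ∫ s in (0:ℝ)..1, s^a * (1-s)^(k+1) = ((k+1) * (((a+1).factorial * k.factorial : ℝ) / (a+1+k+1).factorial)) / (a+1) := by
      rw [eq_div_iff a0]; linarith
    rw [this, Nat.factorial_succ a, Nat.factorial_succ k]
    push_cast
    field_simp

lemma choose_beta (n k : ℕ) (hk : k ≤ n) : (n.choose k : ℝ) * ∫ s in (0:ℝ)..1, s^(n-k) * (1-s)^k = 1/(n+1) := by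
  rw [beta_nat, Nat.sub_add_cancel hk, Nat.cast_choose ℝ hk, Nat.factorial_succ]
  push_cast
  have : (n.factorial : ℝ) ≠ 0 := by positivity
  have : (k.factorial : ℝ) ≠ 0 := by positivity
  have : ((n-k).factorial : ℝ) ≠ 0 := by positivity
  field_simp

lemma choose_beta' (n k : ℕ) (hk : k ≤ n) : (n.choose k : ℝ) * ∫ s in (0:ℝ)..1, s * (s^(n-k) * (1-s)^k) = 
    (n+1-k)/((n+1)*(n+2)) := by
  have : ∀ s : ℝ, s * (s^(n-k) * (1-s)^k) = s^(n-k+1) * (1-s)^k := fun s => by ring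
  simp_rw [this]
  rw [beta_nat, show n - k + 1 + k + 1 = n+1+1 by omega, Nat.cast_choose ℝ hk, Nat.factorial_succ (n+1),
    Nat.factorial_succ n, Nat.factorial_succ (n-k)]
  push_cast [Nat.cast_sub hk]
  have : (n.factorial : ℝ) ≠ 0 := by positivity
  have : (k.factorial : ℝ) ≠ 0 := by positivity
  have : ((n-k).factorial : ℝ) ≠ 0 := by positivity
  field_simp
  ring

lemma secVol_cont (n : ℕ) : Continuous (secVol n) := by unfold secVol; fun_prop

lemma int_secVol (n : ℕ) : ∫ s in (0:ℝ)..1, secVol n s = 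
    (∑ k ∈ Finset.range (n+1), wt (nrad n * √Real.pi) k) / (n+1) := by
  unfold secVol
  rw [intervalIntegral.integral_finsetSum, Finset.sum_div]
  · refine Finset.sum_congr rfl fun k hk => ?_
    rw [intervalIntegral.integral_mul_const]
    simp_rw [mul_assoc]
    rw [intervalIntegral.integral_const_mul, choose_beta n k (by simp at hk; omega)]
    ring
  · intro k _; exact Continuous.intervalIntegrable (by fun_prop) _ _

lemma int_s_secVol (n : ℕ) : ∫ s in (0:ℝ)..1, s * secVol n s = 
    ((n+1) * (∑ k ∈ Finset.range (n+1), wt (nrad n * √Real.pi) k) - 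
      ∑ k ∈ Finset.range (n+1), k * wt (nrad n * √Real.pi) k) / ((n+1)*(n+2)) := by
  unfold secVol
  simp_rw [Finset.mul_sum]
  rw [intervalIntegral.integral_finsetSum, ← Finset.sum_sub_distrib, Finset.sum_div]
  · refine Finset.sum_congr rfl fun k hk => ?_
    have : ∀ s : ℝ, s * ((n.choose k : ℝ) * s^(n-k) * (1-s)^k * wt (nrad n * √Real.pi) k) = 
      (n.choose k : ℝ) * (s * (s^(n-k) * (1-s)^k)) * wt (nrad n * √Real.pi) k := fun s => by ring
    simp_rw [this]
    rw [intervalIntegral.integral_mul_const, intervalIntegral.integral_const_mul, 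
      choose_beta' n k (by simp at hk; omega)]
    ring
  · intro k _; exact Continuous.intervalIntegrable (by fun_prop) _ _

lemma norm_centroid (b : ℝ) (hb : -1 < b) (n : ℕ) : 
    ‖centroid (Mbody 1 b n)‖ = |(∫ p in Mbody 1 b n, p.2) / ∫ p in Mbody 1 b n, (1:ℝ)| := by
  have hM := Mbody_compact b hb n
  have hMm := hM.isClosed.measurableSet
  have hint : IntegrableOn (fun p : EuclideanSpace ℝ (Fin n) × ℝ => p) (Mbody 1 b n) :=
    ContinuousOn.integrableOn_compact hM (by fun_prop)
  have h2 : (∫ p in Mbody 1 b n, p).2 = ∫ p in Mbody 1 b n, p.2 := 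
    ((ContinuousLinearMap.snd ℝ (EuclideanSpace ℝ (Fin n)) ℝ).integral_comp_comm hint).symm
  have h1 : (∫ p in Mbody 1 b n, p).1 = ∫ p in Mbody 1 b n, p.1 := 
    ((ContinuousLinearMap.fst ℝ (EuclideanSpace ℝ (Fin n)) ℝ).integral_comp_comm hint).symm
  have h0 : ∫ p in Mbody 1 b n, p.1 = 0 := by
    have hp : MeasurePreserving (Prod.map (fun x : EuclideanSpace ℝ (Fin n) => -x) (id : ℝ → ℝ)) :=
      (Measure.measurePreserving_neg volume).prod (MeasurePreserving.id volume)
    have he : MeasurableEmbedding (Prod.map (fun x : EuclideanSpace ℝ (Fin n) => -x) (id : ℝ → ℝ)) :=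
      ((MeasurableEquiv.neg _).prodCongr (MeasurableEquiv.refl _)).measurableEmbedding
    have := hp.setIntegral_preimage_emb he (fun p => p.1) (Mbody 1 b n)
    have e : (Prod.map (fun x : EuclideanSpace ℝ (Fin n) => -x) (id : ℝ → ℝ)) ⁻¹' (Mbody 1 b n) = Mbody 1 b n := by
      ext ⟨x, t⟩
      simp only [Set.mem_preimage, Prod.map_apply, id]
      rw [mem_Mbody b hb, mem_Mbody b hb]
      simp [clipSq]
    rw [e] at this
    simp only [Prod.map_fst, integral_neg] at this
    have h2v : (2:ℝ) • ∫ p in Mbody 1 b n, p.1 = 0 := by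
      rw [two_smul]; nth_rewrite 1 [← this]; exact neg_add_cancel _
    exact (smul_eq_zero.1 h2v).resolve_left two_ne_zero
  unfold centroid
  rw [show (∫ p in Mbody 1 b n, p) = (0, ∫ p in Mbody 1 b n, p.2) from Prod.ext (h1.trans h0) h2]
  simp [Prod.norm_def, Measure.real, div_eq_inv_mul]
  positivity

lemma norm_centroid_formula (b : ℝ) (hb : -1 < b) (n : ℕ) (hn : 1 ≤ n) :
    ‖centroid (Mbody 1 b n)‖ = |-1 + (1+b) * (((n:ℝ)+1)/(n+2) - (n:ℝ)/(n+2) * 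
      ((∑ k ∈ Finset.range (n+1), k * wt (nrad n * √Real.pi) k) / 
        (n * ∑ k ∈ Finset.range (n+1), wt (nrad n * √Real.pi) k)))| := by
  have hb' : 0 < 1 + b := by linarith
  have hS : 0 < ∑ k ∈ Finset.range (n+1), wt (nrad n * √Real.pi) k :=
    Finset.sum_pos (fun k _ => wt_pos (nrad_spec n hn).1 k) ⟨0, by simp⟩
  have n0 : (0:ℝ) < n := by exact_mod_cast hn
  have hc := secVol_cont n
  rw [norm_centroid b hb, integral_Mbody b hb n (fun t => t) continuous_id, 
    integral_Mbody b hb n (fun _ => 1) continuous_const]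
  have : ∀ s : ℝ, (-1 + s * (1+b)) * secVol n s = (1+b) * (s * secVol n s) - secVol n s := fun s => by ring
  simp_rw [this, one_mul]
  rw [intervalIntegral.integral_sub (Continuous.intervalIntegrable (by fun_prop) _ _) 
      (Continuous.intervalIntegrable (by fun_prop) _ _), intervalIntegral.integral_const_mul,
      int_secVol, int_s_secVol]
  congr 1
  field_simp
  ring

/-- With `K = B₂ⁿ/vol(B₂ⁿ)^{1/n}`, `L = ½B_∞ⁿ`, `a = 1`, `b = 1/(e-1)` and
`M_n = co[(K,-a),(L,b)]`, the centroid of `M_n` converges to the origin of `ℝ^{n+1}`. -/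
theorem centroid_of_Mbody_tendsto_zero :
    Tendsto (fun n : ℕ => ‖centroid (Mbody 1 (1 / (Real.exp 1 - 1)) n)‖) atTop (nhds 0) := by
  have he : 0 < Real.exp 1 - 1 := by have := Real.exp_one_gt_d9; linarith
  have hb : -1 < 1 / (Real.exp 1 - 1) := by
    have : 0 < 1 / (Real.exp 1 - 1) := by positivity
    linarith
  have hm := mean_lim (fun n => nrad n * √Real.pi) (fun n hn => (nrad_spec n hn).1) 
    (fun n hn => (nrad_spec n hn).2)
  have hi : Tendsto (fun n : ℕ => 1/((n:ℝ)+2)) atTop (nhds 0) := 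
    Tendsto.const_div_atTop (tendsto_atTop_add_const_right _ _ tendsto_natCast_atTop_atTop) _
  have t1 : Tendsto (fun n : ℕ => ((n:ℝ)+1)/(n+2)) atTop (nhds 1) := by
    have := hi.const_sub 1
    rw [sub_zero] at this
    refine this.congr fun n => ?_
    have : (n:ℝ)+2 ≠ 0 := by positivity
    field_simp; ring
  have t2 : Tendsto (fun n : ℕ => (n:ℝ)/(n+2)) atTop (nhds 1) := by
    have := (hi.const_mul 2).const_sub 1
    rw [mul_zero, sub_zero] at this
    refine this.congr fun n => ?_
    have : (n:ℝ)+2 ≠ 0 := by positivity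
    field_simp; ring
  have := (((t1.sub (t2.mul hm)).const_mul (1 + 1 / (Real.exp 1 - 1))).const_add (-1)).abs
  have e : |-1 + (1 + 1 / (Real.exp 1 - 1)) * (1 - 1 * Real.exp (-1))| = 0 := by
    rw [abs_eq_zero, Real.exp_neg]
    field_simp; ring
  rw [e] at this
  refine this.congr' ?_
  filter_upwards [eventually_ge_atTop 1] with n hn
  rw [norm_centroid_formula _ hb n hn]
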